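/- arXiv:1001.3006 — 4 statements merged into one kernel-verified Lean document; each statement's English description precedes it below -/
import Mathlib

section
/- For every λ > 0, the series ∑_{j=1}^∞ λ³/(λ² + π²j²)² converges and equals (1 + 4λe^{−2λ} − e^{−4λ})/(4(1 − e^{−2λ})²) − 1/(2λ). -/
open Real

lemma aux_summable (x : ℝ) :
    Summable (fun j : ℕ => 1 / (x ^ 2 + π ^ 2 * ((j : ℝ) + 1) ^ 2)) := by
  have h : Summable (fun j : ℕ => 1 / ((j : ℝ) + 1) ^ 2) := by
    have := (summable_nat_add_iff 1).mpr (Real.summable_one_div_nat_pow.mpr (one_lt_two))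
    simpa using this
  refine Summable.of_nonneg_of_le (fun j => by positivity) (fun j => ?_) h
  have hpi : 1 ≤ π ^ 2 := by nlinarith [Real.pi_gt_three]
  apply one_div_le_one_div_of_le (by positivity)
  nlinarith [sq_nonneg x, sq_nonneg ((j : ℝ) + 1)]

lemma aux_tsum (x : ℝ) (hx : 0 < x) :
    ∑' j : ℕ, 1 / (x ^ 2 + π ^ 2 * ((j : ℝ) + 1) ^ 2) =
      ((1 + Real.exp (-2 * x)) / (1 - Real.exp (-2 * x)) - 1 / x) / (2 * x) := by
  have hpi : (π : ℂ) ≠ 0 := by exact_mod_cast Real.pi_ne_zero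
  have hxc : (x : ℂ) ≠ 0 := by exact_mod_cast hx.ne'
  set z : ℂ := Complex.I * x / π with hz
  have hzm : z ∈ Complex.integerComplement := by
    rintro ⟨n, hn⟩
    have h1 : Complex.I * x = n * π := by
      have : (n : ℂ) = Complex.I * x / π := hn
      rw [this]; field_simp
    have := congrArg Complex.im h1
    simp at this
    exact hx.ne' this
  have h := cot_series_rep' hzm
  rw [Complex.cot_pi_eq_exp_ratio] at h
  have he : Complex.exp (2 * π * Complex.I * z) = ((Real.exp (-2 * x) : ℝ) : ℂ) := by
    push_cast
    congr 1
    rw [hz]; field_simp; rw [Complex.I_sq]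
  rw [he] at h
  have ht : ∀ n : ℕ, 1 / (z - (n + 1)) + 1 / (z + (n + 1)) =
      (-2 * Complex.I * x * π) * ((1 / (x ^ 2 + π ^ 2 * ((n : ℝ) + 1) ^ 2) : ℝ) : ℂ) := by
    intro n
    have hp : ((x : ℂ) ^ 2 + π ^ 2 * ((n : ℂ) + 1) ^ 2) ≠ 0 := by
      have : (x ^ 2 + π ^ 2 * ((n : ℝ) + 1) ^ 2) ≠ 0 := by positivity
      exact_mod_cast this
    have hI := Complex.I_sq
    have e : (x : ℂ) ^ 2 + π ^ 2 * ((n : ℂ) + 1) ^ 2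
        = -π ^ 2 * ((z - (n + 1)) * (z + (n + 1))) := by
      have : (π : ℂ) * z = Complex.I * x := by rw [hz]; field_simp
      linear_combination ((x : ℂ) ^ 2) * hI + (π * z + Complex.I * x) * this
    have e1 : z - (n + 1) ≠ 0 := by
      intro h0; rw [e, h0] at hp; simp at hp
    have e2 : z + (n + 1) ≠ 0 := by
      intro h0; rw [e, h0] at hp; simp at hp
    push_cast
    rw [e]
    have : (π : ℂ) * z = Complex.I * x := by rw [hz]; field_simp
    field_simp
    linear_combination 2 * this
  rw [tsum_congr ht, tsum_mul_left, ← Complex.ofReal_tsum] at h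
  set S := ∑' j : ℕ, 1 / (x ^ 2 + π ^ 2 * ((j : ℝ) + 1) ^ 2)
  have hq : (1 - Real.exp (-2 * x)) ≠ 0 := by
    have : Real.exp (-2 * x) < 1 := by rw [← Real.exp_zero]; exact Real.exp_lt_exp.mpr (by linarith)
    linarith
  set q := Real.exp (-2 * x)
  have hqc : (1 - (q : ℂ)) ≠ 0 := by exact_mod_cast hq
  have hI := Complex.I_sq
  have key : (S : ℂ) = (((1 + q) / (1 - q) - 1 / x) / (2 * x) : ℝ) := by
    push_cast
    rw [hz] at h
    have hI0 := Complex.I_ne_zero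
    field_simp at h ⊢
    rw [hI] at h
    linear_combination -h
  exact_mod_cast key

/-- Explicit series representation: for every `λ > 0`,
`∑_{j=1}^∞ λ³/(λ² + π²j²)² = (1 + 4λe^{−2λ} − e^{−4λ})/(4(1 − e^{−2λ})²) − 1/(2λ)`. -/
theorem series_representation (l : ℝ) (hl : 0 < l) :
    HasSum (fun j : ℕ => l ^ 3 / (l ^ 2 + π ^ 2 * ((j : ℝ) + 1) ^ 2) ^ 2)
      ((1 + 4 * l * Real.exp (-2 * l) - Real.exp (-4 * l)) /
        (4 * (1 - Real.exp (-2 * l)) ^ 2) - 1 / (2 * l)) := by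
  have hpi : 1 ≤ π ^ 2 := by nlinarith [Real.pi_gt_three]
  have hb : ∀ (x : ℝ) (j : ℕ), 1 ≤ x ^ 2 + π ^ 2 * ((j : ℝ) + 1) ^ 2 := by
    intro x j
    have : (0 : ℝ) ≤ j := by positivity
    nlinarith [sq_nonneg x, sq_nonneg ((j : ℝ) + 1)]
  have hu : Summable (fun j : ℕ => 4 * l * (1 / ((0 : ℝ) ^ 2 + π ^ 2 * ((j : ℝ) + 1) ^ 2))) :=
    (aux_summable 0).mul_left _
  have hbound : ∀ (j : ℕ) (y : ℝ), y ∈ Set.Ioo 0 (2 * l) →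
      ‖-(2 * y) / (y ^ 2 + π ^ 2 * ((j : ℝ) + 1) ^ 2) ^ 2‖ ≤
        4 * l * (1 / ((0 : ℝ) ^ 2 + π ^ 2 * ((j : ℝ) + 1) ^ 2)) := by
    intro j y hy
    have h1 := hb y j
    have h0 := hb 0 j
    rw [norm_div, norm_neg, Real.norm_of_nonneg (by linarith [hy.1]),
      Real.norm_of_nonneg (by positivity), mul_one_div]
    apply div_le_div₀ (by linarith) (by linarith [hy.2]) (by linarith)
    nlinarith [sq_nonneg y]
  have hd := hasDerivAt_tsum_of_isPreconnected hu isOpen_Ioo isPreconnected_Ioo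
    (g := fun (j : ℕ) (y : ℝ) => 1 / (y ^ 2 + π ^ 2 * ((j : ℝ) + 1) ^ 2))
    (fun j y hy => by
      have h1 := hb y j
      have := ((hasDerivAt_pow 2 y).add_const (π ^ 2 * ((j : ℝ) + 1) ^ 2)).inv (by linarith)
      simp only [one_div]
      convert! this using 1
      simp)
    hbound (y₀ := l) ⟨hl, by linarith⟩ (aux_summable l) (y := l) ⟨hl, by linarith⟩
  have hs : Summable (fun j : ℕ => -(2 * l) / (l ^ 2 + π ^ 2 * ((j : ℝ) + 1) ^ 2) ^ 2) :=
    Summable.of_norm_bounded hu (fun j => hbound j l ⟨hl, by linarith⟩)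
  have hq : (1 - Real.exp (-2 * l)) ≠ 0 := by
    have : Real.exp (-2 * l) < 1 := by rw [← Real.exp_zero]; exact Real.exp_lt_exp.mpr (by linarith)
    linarith
  have he : HasDerivAt (fun x : ℝ => Real.exp (-2 * x)) (Real.exp (-2 * l) * (-2)) l := by
    simpa using ((hasDerivAt_id l).const_mul (-2)).exp
  have hd2 := ((((he.const_add 1).div (he.const_sub 1) hq).sub
    ((hasDerivAt_const l (1 : ℝ)).div (hasDerivAt_id l) hl.ne')).div
    ((hasDerivAt_id l).const_mul 2) (by simpa using hl.ne'))
  have heq := hd.unique (hd2.congr_of_eventuallyEq (by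
    filter_upwards [lt_mem_nhds hl] with x hx
    simpa using aux_tsum x hx))
  have hfin := (hs.hasSum.mul_left (-l ^ 2 / 2))
  rw [heq] at hfin
  convert! hfin using 1
  · funext j
    have := hb l j
    field_simp
  · have h4 : Real.exp (-4 * l) = Real.exp (-2 * l) ^ 2 := by
      rw [← Real.exp_nat_mul]; congr 1; push_cast; ring
    rw [h4]
    simp only [id, Pi.div_apply, Pi.sub_apply]
    clear hfin heq hd2 hd he h4
    generalize Real.exp (-2 * l) = q at hq ⊢
    field_simp
    ring
end

section
/- lim_{λ→∞} ∑_{j=1}^∞ λ³/(λ² + π²j²)² = 1/4. Equivalently, for every θ > 0, h₀^{−1} ∑_{j=1}^∞ 1/(2(θ + h₀^{−2}π²j²)²) converges to 1/(8θ^{3/2}) as h₀ → ∞. -/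
open Real Filter Topology

/-- Antiderivative of `1/(1+t²)²`. -/
noncomputable def fisherG (t : ℝ) : ℝ := (t / (1 + t ^ 2) + arctan t) / 2

lemma fisherG_hasDerivAt (t : ℝ) : HasDerivAt fisherG (1 / (1 + t ^ 2) ^ 2) t := by
  have h0 : (1 + t ^ 2) ≠ 0 := by positivity
  have h1 : HasDerivAt (fun t : ℝ => 1 + t ^ 2) (2 * t) t := by
    simpa using (hasDerivAt_pow 2 t).const_add 1
  have h2 := (((hasDerivAt_id t).div h1 h0).add (hasDerivAt_arctan t)).div_const 2
  refine h2.congr_deriv ?_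
  simp only [id]
  field_simp
  ring

lemma fisherG_bounds {a b : ℝ} (ha : 0 ≤ a) (hab : a < b) :
    (b - a) * (1 / (1 + b ^ 2) ^ 2) ≤ fisherG b - fisherG a ∧
    fisherG b - fisherG a ≤ (b - a) * (1 / (1 + a ^ 2) ^ 2) := by
  obtain ⟨c, ⟨hc1, hc2⟩, hc⟩ := exists_hasDerivAt_eq_slope fisherG (fun t => 1 / (1 + t ^ 2) ^ 2)
    hab (fun x _ => (fisherG_hasDerivAt x).continuousAt.continuousWithinAt)
    (fun x _ => fisherG_hasDerivAt x)
  have hpos : 0 < b - a := sub_pos.2 hab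
  have e : fisherG b - fisherG a = (b - a) * (1 / (1 + c ^ 2) ^ 2) := by
    rw [hc]; field_simp
  have hc0 : 0 ≤ c := ha.trans hc1.le
  rw [e]
  constructor <;> gcongr

lemma fisherG_tendsto : Tendsto fisherG atTop (𝓝 (π / 4)) := by
  have h1 : Tendsto (fun t : ℝ => t / (1 + t ^ 2)) atTop (𝓝 0) := by
    refine tendsto_of_tendsto_of_tendsto_of_le_of_le' tendsto_const_nhds tendsto_inv_atTop_zero
      ?_ ?_
    · filter_upwards [eventually_gt_atTop 0] with t ht
      positivity
    · filter_upwards [eventually_gt_atTop 0] with t ht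
      rw [div_le_iff₀ (by positivity)]
      field_simp
      linarith
  have h2 := (h1.add (tendsto_nhds_of_tendsto_nhdsWithin tendsto_arctan_atTop)).div_const 2
  have e : (0 + π / 2) / 2 = π / 4 := by ring
  rw [e] at h2
  exact h2

lemma fisher_bounds {l : ℝ} (hl : 0 < l) :
    1 / 4 - 1 / l ≤ ∑' j : ℕ, l ^ 3 / (l ^ 2 + π ^ 2 * ((j : ℝ) + 1) ^ 2) ^ 2 ∧
    ∑' j : ℕ, l ^ 3 / (l ^ 2 + π ^ 2 * ((j : ℝ) + 1) ^ 2) ^ 2 ≤ 1 / 4 := by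
  have hpi := pi_pos
  set f : ℕ → ℝ := fun j => l ^ 3 / (l ^ 2 + π ^ 2 * (j : ℝ) ^ 2) ^ 2 with hf
  set F : ℕ → ℝ := fun j => fisherG (π * j / l) / π with hF
  have hfe : ∀ j : ℕ, f j = (π / l) * (1 / (1 + (π * j / l) ^ 2) ^ 2) / π := by
    intro j
    simp only [hf]
    have : (1 + (π * j / l) ^ 2) = (l ^ 2 + π ^ 2 * (j : ℝ) ^ 2) / l ^ 2 := by
      field_simp
    rw [this]
    have : l ^ 2 + π ^ 2 * (j : ℝ) ^ 2 ≠ 0 := by positivity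
    field_simp
  have hb : ∀ j : ℕ, f (j + 1) ≤ F (j + 1) - F j ∧ F (j + 1) - F j ≤ f j := by
    intro j
    have hd : π * ((j + 1 : ℕ) : ℝ) / l - π * j / l = π / l := by
      push_cast; ring
    have hlt : π * (j : ℝ) / l < π * ((j + 1 : ℕ) : ℝ) / l := by
      have : 0 < π / l := by positivity
      linarith
    have := fisherG_bounds (by positivity) hlt
    rw [hd] at this
    rw [hfe, hfe]
    simp only [hF]
    rw [← sub_div]
    constructor
    · exact div_le_div_of_nonneg_right this.1 hpi.le
    · exact div_le_div_of_nonneg_right this.2 hpi.le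
  have hf0 : ∀ j, 0 ≤ f j := fun j => by simp only [hf]; positivity
  have hsum : HasSum (fun j => F (j + 1) - F j) (1 / 4) := by
    rw [hasSum_iff_tendsto_nat_of_nonneg (fun j => (hf0 _).trans (hb j).1)]
    have ht : Tendsto (fun n : ℕ => π * (n : ℝ) / l) atTop atTop :=
      (tendsto_natCast_atTop_atTop.const_mul_atTop hpi).atTop_div_const hl
    have h := (fisherG_tendsto.comp ht).div_const π
    have e : π / 4 / π = 1 / 4 := by field_simp
    rw [e] at h
    refine h.congr fun n => ?_
    rw [Finset.sum_range_sub]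
    simp [hF, fisherG]
  have hs1 : Summable (fun j => f (j + 1)) :=
    Summable.of_nonneg_of_le (fun j => hf0 _) (fun j => (hb j).1) hsum.summable
  have hs : Summable f := (summable_nat_add_iff 1).1 hs1
  have e : ∑' j : ℕ, l ^ 3 / (l ^ 2 + π ^ 2 * ((j : ℝ) + 1) ^ 2) ^ 2 = ∑' j, f (j + 1) := by
    simp [hf]
  rw [e]
  constructor
  · have h1 : 1 / 4 ≤ ∑' j, f j := hsum.tsum_eq ▸ hsum.summable.tsum_le_tsum (fun j => (hb j).2) hs
    rw [hs.tsum_eq_zero_add] at h1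
    have h2 : f 0 = 1 / l := by
      simp only [hf]
      push_cast
      field_simp
      ring
    linarith
  · exact hsum.tsum_eq ▸ hs1.tsum_le_tsum (fun j => (hb j).1) hsum.summable

lemma fisher_first :
    Tendsto (fun l : ℝ => ∑' j : ℕ, l ^ 3 / (l ^ 2 + π ^ 2 * ((j : ℝ) + 1) ^ 2) ^ 2)
      atTop (𝓝 (1 / 4)) := by
  have h : Tendsto (fun l : ℝ => 1 / 4 - 1 / l) atTop (𝓝 (1 / 4)) := by
    have := (tendsto_inv_atTop_zero (𝕜 := ℝ)).const_sub (1 / 4)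
    simpa using this
  refine tendsto_of_tendsto_of_tendsto_of_le_of_le' h tendsto_const_nhds ?_ ?_
  · filter_upwards [eventually_gt_atTop 0] with l hl using (fisher_bounds hl).1
  · filter_upwards [eventually_gt_atTop 0] with l hl using (fisher_bounds hl).2

/-- `lim_{λ→∞} ∑_{j=1}^∞ λ³/(λ² + π²j²)² = 1/4`; equivalently, for every `θ > 0`,
`h₀⁻¹ ∑_{j=1}^∞ 1/(2(θ + h₀^{−2}π²j²)²) → 1/(8θ^{3/2})` as `h₀ → ∞`. -/
theorem fisher_information_asymptotics :
    Tendsto (fun l : ℝ => ∑' j : ℕ, l ^ 3 / (l ^ 2 + π ^ 2 * ((j : ℝ) + 1) ^ 2) ^ 2)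
      atTop (𝓝 (1 / 4)) ∧
    ∀ θ : ℝ, 0 < θ →
      Tendsto (fun h₀ : ℝ =>
          h₀⁻¹ * ∑' j : ℕ, 1 / (2 * (θ + h₀ ^ (-2 : ℤ) * π ^ 2 * ((j : ℝ) + 1) ^ 2) ^ 2))
        atTop (𝓝 (1 / (8 * Real.sqrt θ ^ 3))) := by
  refine ⟨fisher_first, fun θ hθ => ?_⟩
  obtain ⟨s, hs, rfl⟩ : ∃ s : ℝ, 0 < s ∧ θ = s ^ 2 :=
    ⟨√θ, Real.sqrt_pos.2 hθ, (Real.sq_sqrt hθ.le).symm⟩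
  rw [Real.sqrt_sq hs.le]
  have h := (fisher_first.comp (tendsto_id.atTop_mul_const hs)).const_mul (1 / (2 * s ^ 3))
  have e : 1 / (2 * s ^ 3) * (1 / 4) = 1 / (8 * s ^ 3) := by
    field_simp; norm_num
  rw [e] at h
  refine h.congr' ?_
  filter_upwards [eventually_gt_atTop 0] with x hx
  simp only [Function.comp, id]
  rw [← tsum_mul_left, ← tsum_mul_left]
  refine tsum_congr fun j => ?_
  have hx2 : x ^ (-2 : ℤ) = 1 / x ^ 2 := by
    rw [zpow_neg, one_div]; norm_cast
  have e2 : s ^ 2 + x ^ (-2 : ℤ) * π ^ 2 * ((j : ℝ) + 1) ^ 2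
      = ((x * s) ^ 2 + π ^ 2 * ((j : ℝ) + 1) ^ 2) / x ^ 2 := by
    rw [hx2]; field_simp
  rw [e2]
  have h3 : (x * s) ^ 2 + π ^ 2 * ((j : ℝ) + 1) ^ 2 ≠ 0 := by positivity
  generalize (x * s) ^ 2 + π ^ 2 * ((j : ℝ) + 1) ^ 2 = D at *
  field_simp
end

section
/- Let α ∈ (0,1], R > 0, and let f : [0,1] → ℝ be differentiable with |f'(x) − f'(y)| ≤ R|x − y|^α for all x, y ∈ [0,1]. Then for every n ∈ ℕ, n ≥ 1, and every c ∈ [1/(2n), 1 − 1/(2n)], | n ∫_{c − 1/(2n)}^{c + 1/(2n)} (f(t) − f(c)) dt | ≤ R n^{−1−α}. -/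
open Real MeasureTheory

/-- If `f'` is `α`-Hölder with constant `R` on `[0,1]`, then the symmetric local average
of `f − f(c)` around `c` over an interval of length `1/n` is bounded by `R n^{−1−α}`. -/
theorem symmetric_average_bound (α R : ℝ) (hα : α ∈ Set.Ioc (0 : ℝ) 1) (hR : 0 < R)
    (f f' : ℝ → ℝ)
    (hderiv : ∀ x ∈ Set.Icc (0 : ℝ) 1, HasDerivWithinAt f (f' x) (Set.Icc (0 : ℝ) 1) x)
    (hHolder : ∀ x ∈ Set.Icc (0 : ℝ) 1, ∀ y ∈ Set.Icc (0 : ℝ) 1,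
      |f' x - f' y| ≤ R * |x - y| ^ α)
    (n : ℕ) (hn : 1 ≤ n) (c : ℝ)
    (hc : c ∈ Set.Icc (1 / (2 * (n : ℝ))) (1 - 1 / (2 * (n : ℝ)))) :
    |(n : ℝ) * ∫ t in (c - 1 / (2 * (n : ℝ)))..(c + 1 / (2 * (n : ℝ))), (f t - f c)|
      ≤ R * (n : ℝ) ^ (-1 - α) := by
  obtain ⟨hα0, hα1⟩ := hα
  obtain ⟨hc1, hc2⟩ := hc
  have hnpos : (0 : ℝ) < n := by exact_mod_cast hn
  have hnh : (n : ℝ) * (2 * (1 / (2 * (n : ℝ)))) = 1 := by field_simp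
  have hhn : 1 / (2 * (n : ℝ)) ≤ (n : ℝ)⁻¹ := by
    rw [← one_div]
    apply one_div_le_one_div_of_le hnpos
    linarith
  have hpos : 0 < 1 / (2 * (n : ℝ)) := by positivity
  generalize 1 / (2 * (n : ℝ)) = h at *
  have hsub : Set.Icc (c - h) (c + h) ⊆ Set.Icc (0 : ℝ) 1 :=
    Set.Icc_subset_Icc (by linarith) (by linarith)
  have hcm : c ∈ Set.Icc (c - h) (c + h) := ⟨by linarith, by linarith⟩
  have habs : ∀ t ∈ Set.Icc (c - h) (c + h), |t - c| ≤ h := by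
    intro t ht
    rw [abs_le]
    exact ⟨by linarith [ht.1], by linarith [ht.2]⟩
  have key : ∀ t ∈ Set.Icc (c - h) (c + h),
      |f t - f c - f' c * (t - c)| ≤ R * h ^ α * h := by
    intro t ht
    have hd : ∀ x ∈ Set.Icc (c - h) (c + h),
        HasDerivWithinAt (fun y => f y - f' c * y) (f' x - f' c * 1)
          (Set.Icc (c - h) (c + h)) x := fun x hx =>
      ((hderiv x (hsub hx)).mono hsub).sub ((hasDerivWithinAt_id x _).const_mul (f' c))
    have hb : ∀ x ∈ Set.Icc (c - h) (c + h), ‖f' x - f' c * 1‖ ≤ R * h ^ α := by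
      intro x hx
      rw [mul_one, Real.norm_eq_abs]
      refine (hHolder x (hsub hx) c (hsub hcm)).trans ?_
      have := Real.rpow_le_rpow (abs_nonneg _) (habs x hx) hα0.le
      gcongr
    have := (convex_Icc (c - h) (c + h)).norm_image_sub_le_of_norm_hasDerivWithin_le hd hb hcm ht
    rw [Real.norm_eq_abs, Real.norm_eq_abs] at this
    have e : f t - f c - f' c * (t - c) = f t - f' c * t - (f c - f' c * c) := by ring
    rw [e]
    refine this.trans ?_
    have := habs t ht
    gcongr
  have hle : c - h ≤ c + h := by linarith
  have hfc : ContinuousOn f (Set.uIcc (c - h) (c + h)) := by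
    rw [Set.uIcc_of_le hle]
    exact fun x hx => ((hderiv x (hsub hx)).mono hsub).continuousWithinAt
  have hi1 : IntervalIntegrable (fun t => f t - f c) volume (c - h) (c + h) :=
    (hfc.sub continuousOn_const).intervalIntegrable
  have hi2 : IntervalIntegrable (fun t => f' c * (t - c)) volume (c - h) (c + h) :=
    Continuous.intervalIntegrable (by fun_prop) _ _
  have hz : ∫ t in (c - h)..(c + h), f' c * (t - c) = 0 := by
    rw [intervalIntegral.integral_const_mul,
      intervalIntegral.integral_comp_sub_right (fun t => t), integral_id]
    ring
  have hI : ∫ t in (c - h)..(c + h), (f t - f c)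
      = ∫ t in (c - h)..(c + h), (f t - f c - f' c * (t - c)) := by
    rw [intervalIntegral.integral_sub hi1 hi2, hz, sub_zero]
  have hB : |∫ t in (c - h)..(c + h), (f t - f c)| ≤ R * h ^ α * h * (2 * h) := by
    rw [hI]
    have := intervalIntegral.norm_integral_le_of_norm_le_const (a := c - h) (b := c + h)
      (f := fun t => f t - f c - f' c * (t - c)) (C := R * h ^ α * h) (by
        intro t ht
        rw [Set.uIoc_of_le hle] at ht
        exact key t ⟨ht.1.le, ht.2⟩)
    have e : |c + h - (c - h)| = 2 * h := by
      rw [show c + h - (c - h) = 2 * h by ring, abs_of_pos (by linarith)]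
    rwa [e] at this
  have hfin : (n : ℝ) ^ (-1 - α) = ((n : ℝ)⁻¹) ^ (α + 1) := by
    rw [Real.inv_rpow hnpos.le, ← Real.rpow_neg hnpos.le]
    congr 1
    ring
  rw [abs_mul, abs_of_pos hnpos, hfin]
  calc (n : ℝ) * |∫ t in (c - h)..(c + h), (f t - f c)|
      ≤ n * (R * h ^ α * h * (2 * h)) := by gcongr
    _ = R * (h ^ α * h) * (n * (2 * h)) := by ring
    _ = R * h ^ (α + 1) := by rw [hnh, mul_one, Real.rpow_add_one hpos.ne']
    _ ≤ R * ((n : ℝ)⁻¹) ^ (α + 1) := by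
      have := Real.rpow_le_rpow hpos.le hhn (by linarith : 0 ≤ α + 1)
      gcongr
end

section
/- Define σ_n(t) = (1 + n^{−1/4} cos(πnt))^{1/2} for t ∈ [0,1]. There exist constants c, C > 0 such that for all sufficiently large n ∈ ℕ, c n^{−1/2} ≤ ∫_0^1 (√(2σ_n(t)) − √2)² dt ≤ C n^{−1/2}. -/
open Real MeasureTheory

lemma aux_pt (x : ℝ) (h1 : -1 ≤ x) (h2 : x ≤ 1) :
    2 / 225 * x ^ 2 ≤ (Real.sqrt (2 * Real.sqrt (1 + x)) - Real.sqrt 2) ^ 2 ∧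
    (Real.sqrt (2 * Real.sqrt (1 + x)) - Real.sqrt 2) ^ 2 ≤ 2 * x ^ 2 := by
  set r := Real.sqrt (1 + x) with hr
  have hr0 : 0 ≤ r := Real.sqrt_nonneg _
  have hr2 : r ^ 2 = 1 + x := Real.sq_sqrt (by linarith)
  set s := Real.sqrt r with hs
  have hs0 : 0 ≤ s := Real.sqrt_nonneg _
  have hs2 : s ^ 2 = r := Real.sq_sqrt hr0
  have e : (Real.sqrt (2 * r) - Real.sqrt 2) ^ 2 = 2 * (s - 1) ^ 2 := by
    rw [Real.sqrt_mul (by norm_num)]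
    have : Real.sqrt 2 ^ 2 = 2 := Real.sq_sqrt (by norm_num)
    calc (Real.sqrt 2 * s - Real.sqrt 2) ^ 2 = Real.sqrt 2 ^ 2 * (s - 1) ^ 2 := by ring
      _ = _ := by rw [this]
  rw [e]
  have hrle : r ≤ 2 := by nlinarith
  have hsle : s ≤ 2 := by nlinarith
  have hx : x = (s - 1) * ((s + 1) * (s ^ 2 + 1)) := by
    have : s ^ 4 = 1 + x := by rw [← hr2, ← hs2]; ring
    linarith [this]
  set k := (s + 1) * (s ^ 2 + 1) with hk
  have hk1 : 1 ≤ k := by rw [hk, hs2]; nlinarith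
  have hk2 : k ≤ 15 := by rw [hk, hs2]; nlinarith
  have hx2 : x ^ 2 = (s - 1) ^ 2 * k ^ 2 := by rw [hx]; ring
  rw [hx2]
  have a1 : 1 ≤ k ^ 2 := by nlinarith
  have a2 : k ^ 2 ≤ 225 := by nlinarith
  have := sq_nonneg (s - 1)
  constructor <;> nlinarith

lemma aux_int (n : ℕ) (hn : 1 ≤ n) :
    ∫ t in (0 : ℝ)..1, Real.cos (π * n * t) ^ 2 = 1 / 2 := by
  have hc : π * (n : ℝ) ≠ 0 := by
    have : (n : ℝ) ≠ 0 := by positivity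
    exact mul_ne_zero Real.pi_ne_zero this
  rw [intervalIntegral.integral_comp_mul_left (fun u => Real.cos u ^ 2) hc, integral_cos_sq]
  have : Real.sin (π * n) = 0 := by rw [mul_comm]; exact Real.sin_nat_mul_pi n
  simp only [mul_one, mul_zero, this, Real.sin_zero, smul_eq_mul]
  field_simp
  ring

/-- For `σ_n(t) = (1 + n^{−1/4} cos(πnt))^{1/2}`, the squared `L²`-distance
`∫_0^1 (√(2σ_n(t)) − √2)² dt` is of exact order `n^{−1/2}` for large `n`. -/
theorem counterexample_signal_distance :
    ∃ c C : ℝ, 0 < c ∧ 0 < C ∧ ∃ N : ℕ, ∀ n : ℕ, N ≤ n →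
      c * (n : ℝ) ^ (-(1 : ℝ) / 2)
        ≤ (∫ t in (0 : ℝ)..1,
            (Real.sqrt (2 * Real.sqrt (1 + (n : ℝ) ^ (-(1 : ℝ) / 4) * Real.cos (π * n * t)))
              - Real.sqrt 2) ^ 2) ∧
      (∫ t in (0 : ℝ)..1,
          (Real.sqrt (2 * Real.sqrt (1 + (n : ℝ) ^ (-(1 : ℝ) / 4) * Real.cos (π * n * t)))
            - Real.sqrt 2) ^ 2)
        ≤ C * (n : ℝ) ^ (-(1 : ℝ) / 2) := by
  refine ⟨1 / 225, 1, by norm_num, by norm_num, 1, fun n hn => ?_⟩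
  have hn1 : (1 : ℝ) ≤ n := by exact_mod_cast hn
  have hsq : (n : ℝ) ^ (-(1 : ℝ) / 2) = ((n : ℝ) ^ (-(1 : ℝ) / 4)) ^ 2 := by
    rw [← Real.rpow_natCast, ← Real.rpow_mul (by positivity)]
    norm_num
  have ha0 : 0 ≤ (n : ℝ) ^ (-(1 : ℝ) / 4) := by positivity
  have ha1 : (n : ℝ) ^ (-(1 : ℝ) / 4) ≤ 1 :=
    Real.rpow_le_one_of_one_le_of_nonpos hn1 (by norm_num)
  rw [hsq]
  generalize (n : ℝ) ^ (-(1 : ℝ) / 4) = a at *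
  have key : ∀ t : ℝ, _ := fun t => aux_pt (a * Real.cos (π * n * t))
    (by nlinarith [Real.neg_one_le_cos (π * n * t)])
    (by nlinarith [Real.cos_le_one (π * n * t)])
  have hI : ∀ d : ℝ, ∫ t in (0 : ℝ)..1, d * (a * Real.cos (π * n * t)) ^ 2 = d / 2 * a ^ 2 := by
    intro d
    have : ∀ t : ℝ, d * (a * Real.cos (π * n * t)) ^ 2 = (d * a ^ 2) * Real.cos (π * n * t) ^ 2 :=
      fun t => by ring
    simp_rw [this]
    rw [intervalIntegral.integral_const_mul, aux_int n hn]
    ring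
  constructor
  · have h := hI (2 / 225)
    rw [show (1 / 225 : ℝ) = 2 / 225 / 2 by norm_num, ← h]
    exact intervalIntegral.integral_mono (by norm_num)
      (Continuous.intervalIntegrable (by fun_prop) _ _)
      (Continuous.intervalIntegrable (by fun_prop) _ _) (fun t => (key t).1)
  · have h := hI 2
    rw [show (1 : ℝ) * a ^ 2 = 2 / 2 * a ^ 2 by norm_num, ← h]
    exact intervalIntegral.integral_mono (by norm_num)
      (Continuous.intervalIntegrable (by fun_prop) _ _)
      (Continuous.intervalIntegrable (by fun_prop) _ _) (fun t => (key t).2)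
end
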